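/- For all Schwartz functions f, g : ℝ → ℝ, the pointwise product f·d⁻¹(g) is again a Schwartz function from ℝ to ℝ. -/

import Mathlib

open MeasureTheory Filter Topology

/-- The operator `d⁻¹` : `d⁻¹(f)(x) = (1/2)(∫_{-∞}^x f − ∫_x^{+∞} f)`. -/
noncomputable def dInv (f : ℝ → ℝ) (x : ℝ) : ℝ :=
  (1 / 2) * ((∫ z in Set.Iic x, f z) - (∫ z in Set.Ici x, f z))

theorem dInv_hasDerivAt (g : SchwartzMap ℝ ℝ) (x : ℝ) :
    HasDerivAt (dInv (fun z => g z)) (g x) x := by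
  have hi : Integrable (fun z => g z) := g.integrable
  have h : dInv (fun z => g z) = fun x => (∫ z in (0:ℝ)..x, g z) +
      ((∫ z in Set.Iic (0:ℝ), g z) - (1/2) * ∫ z, g z) := by
    funext x
    have h1 := intervalIntegral.integral_Iic_add_Ioi (b := x) hi.integrableOn hi.integrableOn
    have h2 := intervalIntegral.integral_Iic_sub_Iic (a := 0) (b := x) hi.integrableOn hi.integrableOn
    rw [dInv, integral_Ici_eq_integral_Ioi]
    linarith
  rw [h]
  exact (intervalIntegral.integral_hasDerivAt_right (hi.intervalIntegrable)
    (g.continuous.stronglyMeasurableAtFilter _ _) g.continuous.continuousAt).add_const _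

theorem dInv_bound (g : SchwartzMap ℝ ℝ) (x : ℝ) :
    ‖dInv (fun z => g z) x‖ ≤ ∫ z, ‖g z‖ := by
  have hi : Integrable (fun z => g z) := g.integrable
  have key (s : Set ℝ) : |∫ z in s, g z| ≤ ∫ z, ‖g z‖ :=
    (norm_integral_le_integral_norm _).trans
      (setIntegral_le_integral hi.norm (Eventually.of_forall fun _ => norm_nonneg _))
  have h1 := abs_le.1 (key (Set.Iic x))
  have h2 := abs_le.1 (key (Set.Ici x))
  rw [Real.norm_eq_abs, abs_le, dInv]
  constructor <;> linarith [h1.1, h1.2, h2.1, h2.2]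

theorem dInv_temperate (g : SchwartzMap ℝ ℝ) :
    (dInv (fun z => g z)).HasTemperateGrowth := by
  refine Function.HasTemperateGrowth.of_fderiv (k := 0) (C := ∫ z, ‖g z‖) ?_
    (fun x => (dInv_hasDerivAt g x).differentiableAt) (fun x => by simpa using dInv_bound g x)
  have : fderiv ℝ (dInv (fun z => g z)) =
      fun x => ContinuousLinearMap.toSpanSingletonCLE (𝕜 := ℝ) (g x) := by
    funext x
    rw [(dInv_hasDerivAt g x).hasFDerivAt.fderiv]
    rfl
  rw [this]
  exact (ContinuousLinearMap.hasTemperateGrowth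
    (ContinuousLinearMap.toSpanSingletonCLE (𝕜 := ℝ) (E := ℝ)).toContinuousLinearMap).comp
      g.hasTemperateGrowth

theorem stmt2 (f g : SchwartzMap ℝ ℝ) :
    ∃ h : SchwartzMap ℝ ℝ, ∀ x : ℝ, h x = f x * dInv (fun z => g z) x :=  by
  refine ⟨SchwartzMap.smulLeftCLM ℝ (dInv (fun z => g z)) f, fun x => ?_⟩
  rw [SchwartzMap.smulLeftCLM_apply_apply (dInv_temperate g), smul_eq_mul, mul_comm]
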